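/- arXiv:2406.01901 — 2 statements merged into one kernel-verified Lean document; each statement's English description precedes it below -/
import Mathlib

section
/- Let f : S × S → ℝ be a nonnegative edge flow supported on the edges E, and let F : S → ℝ be positive at every state, with F(s') = ∑_{u ∈ Parents(s')} f(u → s') for every non-initial state s', F(s₀) = ∑_{v ∈ Children(s₀)} f(s₀ → v), and the flow matching condition ∑_{u ∈ Parents(s')} f(u → s') = ∑_{v ∈ Children(s')} f(s' → v) at every state s' that is neither initial nor terminal. Define the forward policy P(s'|s) := f(s → s') / F(s). Then for every state s ∈ S, the sum over all directed paths τ = (s₀ = t₀, t₁, …, t_n = s) from s₀ to s of the product ∏_{i=0}^{n-1} P(t_{i+1}|t_i) equals F(s) / F(s₀). -/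
/-- Product of the forward-policy values along a path given as a list of states:
for `[t₀, t₁, …, tₙ]` this is `∏_{i=0}^{n-1} P tᵢ tᵢ₊₁` (with empty product `1`). -/
def pathProd {S : Type*} (A : S → S → ℝ) : List S → ℝ
  | [] => 1
  | [_] => 1
  | a :: b :: l => A a b * pathProd A (b :: l)

/-- `IsDiPath E a b l` says the list `l = [t₀, …, tₙ]` is a directed path from `a` to `b`
in the edge relation `E`: consecutive entries are joined by edges, the first entry is `a`
and the last entry is `b`. The trivial path `[a]` from `a` to `a` is allowed, and its
`pathProd` is the empty product `1`. -/
def IsDiPath {S : Type*} (E : S → S → Prop) (a b : S) (l : List S) : Prop :=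
  l.Chain' E ∧ l.head? = some a ∧ l.getLast? = some b

theorem pathProd_append_singleton {S : Type*} (A : S → S → ℝ) {l : List S} {u : S}
    (hu : l.getLast? = some u) (c : S) :
    pathProd A (l ++ [c]) = pathProd A l * A u c := by
  induction l with
  | nil => simp at hu
  | cons a l ih =>
    cases l with
    | nil =>
      obtain rfl : a = u := by simpa using hu
      simp [pathProd]
    | cons b l =>
      have h := ih (by simpa using hu)
      simp only [List.cons_append, pathProd] at h ⊢
      rw [h, mul_assoc]

theorem isDiPath_iff {S : Type*} {E : S → S → Prop} {a b : S} {l : List S} :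
    IsDiPath E a b l ↔ l.IsChain E ∧ l.head? = some a ∧ l.getLast? = some b :=
  Iff.rfl

theorem isDiPath_append_singleton {S : Type*} {E : S → S → Prop} {a b c : S} {l : List S} :
    IsDiPath E a b (l ++ [c]) ↔
      c = b ∧ (l = [] ∧ a = b ∨ ∃ u, E u b ∧ IsDiPath E a u l) := by
  rcases l.eq_nil_or_concat with rfl | ⟨l, u, rfl⟩
  · simp [isDiPath_iff]
    grind
  · simp [isDiPath_iff, List.isChain_append]
    grind

/-- A directed path between distinct states is a directed path to a parent of its endpoint,
followed by the endpoint. -/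
theorem setOf_isDiPath_of_ne {S : Type*} (E : S → S → Prop) {a b : S} (hab : b ≠ a) :
    {l | IsDiPath E a b l} =
      ⋃ u ∈ {u | E u b}, (fun l => l ++ [b]) '' {l | IsDiPath E a u l} := by
  ext l
  rcases l.eq_nil_or_concat with rfl | ⟨l, c, rfl⟩
  · simp [IsDiPath]
  · simp only [List.concat_eq_append, Set.mem_ofPred_eq, isDiPath_append_singleton, Set.mem_iUnion,
      Set.mem_image, List.append_singleton_inj]
    grind

theorem setOf_isDiPath_self {S : Type*} (E : S → S → Prop) {a : S} (ha : ∀ u, ¬ E u a) :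
    {l | IsDiPath E a a l} = {[a]} := by
  ext l
  rcases l.eq_nil_or_concat with rfl | ⟨l, c, rfl⟩
  · simp [IsDiPath]
  · simp only [List.concat_eq_append, Set.mem_ofPred_eq, isDiPath_append_singleton,
      Set.mem_singleton_iff, List.append_eq_singleton_iff]
    grind

theorem wellFounded_of_transGen_irrefl {S : Type*} [Finite S] {E : S → S → Prop}
    (hE : ∀ s, ¬ Relation.TransGen E s s) : WellFounded E :=
  haveI : Std.Irrefl (Relation.TransGen E) := ⟨hE⟩
  Subrelation.wf Relation.TransGen.single
    (Finite.wellFounded_of_trans_of_irrefl (Relation.TransGen E))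

theorem finite_setOf_isDiPath {S : Type*} [Finite S] {E : S → S → Prop} (hE : WellFounded E)
    {a : S} (ha : ∀ u, ¬ E u a) (s : S) : {l | IsDiPath E a s l}.Finite := by
  induction s using hE.induction with
  | _ s ih =>
    by_cases hs : s = a
    · subst hs
      simp [setOf_isDiPath_self E ha]
    · rw [setOf_isDiPath_of_ne E hs]
      exact (Set.toFinite _).biUnion fun u hu => (ih u hu).image _

/-- The path sums satisfy the one-step recursion over the parents of the endpoint. -/
theorem finsum_pathProd_of_ne {S : Type*} [Fintype S] {E : S → S → Prop} [DecidableRel E]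
    (hE : WellFounded E) {a : S} (ha : ∀ u, ¬ E u a) (A : S → S → ℝ) {s : S} (hs : s ≠ a) :
    (∑ᶠ l ∈ {l | IsDiPath E a s l}, pathProd A l) =
      ∑ u ∈ Finset.univ.filter (fun u => E u s),
        (∑ᶠ l ∈ {l | IsDiPath E a u l}, pathProd A l) * A u s := by
  rw [setOf_isDiPath_of_ne E hs, finsum_mem_biUnion _ (Set.toFinite _)
    fun u _ => (finite_setOf_isDiPath hE ha u).image _]
  · rw [← finsum_mem_coe_finset]
    refine finsum_mem_congr (by simp) fun u _ => ?_
    rw [finsum_mem_image (List.append_left_injective [s]).injOn,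
      finsum_mem_mul]
    exact finsum_mem_congr rfl fun l hl => pathProd_append_singleton A hl.2.2 s
  · intro u _ v _ huv
    rw [Function.onFun, Set.disjoint_left]
    rintro _ ⟨l, hl, rfl⟩ ⟨m, hm, hml⟩
    obtain rfl : m = l := List.append_left_injective [s] hml
    exact huv (Option.some_injective _ (hl.2.2.symm.trans hm.2.2))


/-- Let `f` be a nonnegative edge flow supported on the edges and `F` a
positive state flow with `F s'` equal to the inflow at every non-initial state `s'`,
`F s₀` equal to the outflow of the initial state, and the flow matching condition holding
at every state that is neither initial nor terminal. With the forward policy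
`P s s' := f s s' / F s`, for every state `s` the sum over all directed paths from `s₀`
to `s` of the product of `P` along the path equals `F s / F s₀`. -/
theorem forward_policy_reaches_state_with_probability_flow_ratio
    {S : Type*} [Fintype S] [DecidableEq S]
    (E : S → S → Prop) [DecidableRel E]
    -- the transitive closure of `E` is irreflexive (finite DAG)
    (hacyc : ∀ s : S, ¬ Relation.TransGen E s s)
    (s₀ : S)
    -- the initial state has no incoming edges
    (hs₀_no_in : ∀ u : S, ¬ E u s₀)
    -- every state is reachable from the initial state
    (hreach : ∀ s : S, Relation.ReflTransGen E s₀ s)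
    -- the initial state is not terminal
    (hs₀_not_term : ∃ v : S, E s₀ v)
    (f : S → S → ℝ)
    -- `f` is a nonnegative edge flow supported on the edges
    (hf_nonneg : ∀ s s' : S, 0 ≤ f s s')
    (hf_supp : ∀ s s' : S, ¬ E s s' → f s s' = 0)
    (F : S → ℝ)
    (hF_pos : ∀ s : S, 0 < F s)
    -- the state flow at every non-initial state equals its inflow
    (hF_in : ∀ s' : S, s' ≠ s₀ →
      F s' = ∑ u ∈ Finset.univ.filter (fun u => E u s'), f u s')
    -- the state flow at the initial state equals its outflow
    (hF_s₀ : F s₀ = ∑ v ∈ Finset.univ.filter (fun v => E s₀ v), f s₀ v)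
    -- flow matching at every state that is neither initial nor terminal
    (hfm : ∀ s' : S, s' ≠ s₀ → (∃ v : S, E s' v) →
      (∑ u ∈ Finset.univ.filter (fun u => E u s'), f u s') =
        ∑ v ∈ Finset.univ.filter (fun v => E s' v), f s' v)
    -- the forward policy
    (P : S → S → ℝ)
    (hP : ∀ s s' : S, P s s' = f s s' / F s) :
    ∀ s : S,
      (∑ᶠ l ∈ {l : List S | IsDiPath E s₀ s l}, pathProd P l) = F s / F s₀ := by
  have hE := wellFounded_of_transGen_irrefl hacyc
  intro s
  induction s using hE.induction with
  | _ s ih =>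
    by_cases hs : s = s₀
    · subst hs
      rw [setOf_isDiPath_self E hs₀_no_in, finsum_mem_singleton, pathProd,
        div_self (hF_pos s).ne']
    · rw [finsum_pathProd_of_ne hE hs₀_no_in P hs, hF_in s hs, Finset.sum_div]
      refine Finset.sum_congr rfl fun u hu => ?_
      rw [ih u (by simpa using hu), hP]
      have := (hF_pos u).ne'
      field_simp
end

section
/- Suppose F : S → ℝ satisfies F(s) > 0 for every state s, the allocation A is normalized (for every non-terminal state s, ∑_{v ∈ Children(s)} A(v|s) = 1), and for every non-initial state s' one has ∑_{u ∈ Parents(s')} F(u)·A(s'|u) = F(s'). Then the allocations define a probability distribution over complete trajectories: the sum over all terminal states x ∈ X and all directed paths τ = (s₀ = t₀, t₁, …, t_n = x) from s₀ to x of the product ∏_{i=0}^{n-1} A(t_{i+1}|t_i) equals 1. -/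
section DirectedPaths

variable {S : Type*} {E : S → S → Prop}

theorem isDiPath_iff_s5 {s x : S} {l : List S} :
    IsDiPath E s x l ↔
      (s = x ∧ l = [s]) ∨ ∃ v, E s v ∧ ∃ l', IsDiPath E v x l' ∧ s :: l' = l := by
  unfold IsDiPath
  rcases l with _ | ⟨a, _ | ⟨b, l⟩⟩
  · simp
  · simp only [List.head?_cons, List.getLast?_singleton, Option.some.injEq, List.cons.injEq,
      and_true]
    constructor
    · rintro ⟨-, rfl, rfl⟩
      exact Or.inl ⟨rfl, rfl⟩
    · rintro (⟨rfl, rfl⟩ | ⟨v, -, l', ⟨-, h, -⟩, -, rfl⟩)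
      · exact ⟨List.isChain_singleton _, rfl, rfl⟩
      · simp at h
  · constructor
    · rintro ⟨hc, ha, hl⟩
      obtain rfl : a = s := by simpa using ha
      obtain ⟨hab, hc⟩ := List.isChain_cons_cons.1 hc
      exact Or.inr ⟨b, hab, b :: l, ⟨hc, rfl, by simpa using hl⟩, rfl⟩
    · rintro (⟨-, h⟩ | ⟨v, hv, l', ⟨hc, hh, hl⟩, h⟩)
      · simp at h
      · obtain ⟨rfl, rfl⟩ := List.cons.inj h
        obtain rfl : b = v := by simpa using hh
        exact ⟨List.isChain_cons_cons.2 ⟨hv, hc⟩, rfl, by simpa using hl⟩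

theorem setOf_isDiPath_of_ne_s5 {s x : S} (hsx : s ≠ x) :
    {l | IsDiPath E s x l} = ⋃ v ∈ {v | E s v}, List.cons s '' {l | IsDiPath E v x l} := by
  ext l
  simp [isDiPath_iff_s5 (s := s), hsx]

theorem setOf_isDiPath_self_of_terminal {x : S} (hx : ∀ v, ¬ E x v) :
    {l | IsDiPath E x x l} = {[x]} := by
  ext l
  simp [isDiPath_iff_s5 (s := x), hx]

theorem pathProd_cons_of_isDiPath (A : S → S → ℝ) {s v x : S} {l : List S}
    (h : IsDiPath E v x l) : pathProd A (s :: l) = A s v * pathProd A l := by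
  rcases l with _ | ⟨b, l⟩
  · simp [IsDiPath] at h
  · obtain rfl : b = v := by simpa using h.2.1
    rfl

variable [Finite S]

theorem wellFounded_flip_of_acyclic (hacyc : ∀ s, ¬ Relation.TransGen E s s) :
    WellFounded (flip E) := by
  have : IsTrans S (flip (Relation.TransGen E)) := ⟨fun _ _ _ h₁ h₂ => h₂.trans h₁⟩
  have : Std.Irrefl (flip (Relation.TransGen E)) := ⟨hacyc⟩
  exact Subrelation.wf (r := flip (Relation.TransGen E)) (fun h => Relation.TransGen.single h)
    (Finite.wellFounded_of_trans_of_irrefl (flip (Relation.TransGen E)))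

theorem finite_setOf_isDiPath_s5 (hwf : WellFounded (flip E)) (s x : S) :
    {l | IsDiPath E s x l}.Finite := by
  induction s using hwf.induction with
  | _ s ih =>
    refine ((Set.finite_singleton [s]).union <| (Set.toFinite {v | E s v}).biUnion fun v hv =>
      (ih v hv).image (List.cons s)).subset fun l hl => ?_
    rcases isDiPath_iff_s5.1 hl with ⟨-, rfl⟩ | ⟨v, hv, hl⟩
    · exact Or.inl rfl
    · exact Or.inr (Set.mem_biUnion hv hl)

theorem finsum_pathProd_of_ne_s5 (hwf : WellFounded (flip E)) (A : S → S → ℝ) {s x : S}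
    (hsx : s ≠ x) :
    ∑ᶠ l ∈ {l | IsDiPath E s x l}, pathProd A l =
      ∑ᶠ v ∈ {v | E s v}, A s v * ∑ᶠ l ∈ {l | IsDiPath E v x l}, pathProd A l := by
  rw [setOf_isDiPath_of_ne_s5 hsx, finsum_mem_biUnion _ (Set.toFinite _)
    fun v _ => (finite_setOf_isDiPath_s5 hwf v x).image _]
  · refine finsum_mem_congr rfl fun v _ => ?_
    rw [finsum_mem_image List.cons_injective.injOn, mul_finsum_mem' _ _ (finite_setOf_isDiPath_s5 hwf v x)]
    exact finsum_mem_congr rfl fun l hl => pathProd_cons_of_isDiPath A hl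
  · intro v _ w _ hvw
    refine Set.disjoint_left.2 ?_
    rintro _ ⟨l, hl, rfl⟩ ⟨l', hl', h⟩
    obtain rfl := List.cons_injective h
    exact hvw (Option.some.inj (hl.2.1.symm.trans hl'.2.1))

end DirectedPaths

/-- From every state, the allocation products over all paths to terminal states sum to `1`. -/
theorem sum_finsum_pathProd_eq_one {S : Type*} [Fintype S] {E : S → S → Prop} [DecidableRel E]
    (hwf : WellFounded (flip E)) {A : S → S → ℝ}
    (hA : ∀ s, (∃ v, E s v) → ∑ v ∈ Finset.univ.filter (fun v => E s v), A s v = 1) (s : S) :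
    ∑ x ∈ Finset.univ.filter (fun x => ∀ v, ¬ E x v),
      ∑ᶠ l ∈ {l | IsDiPath E s x l}, pathProd A l = 1 := by
  induction s using hwf.induction with
  | _ s ih =>
    by_cases hs : ∃ v, E s v
    · have hstep : ∀ x ∈ Finset.univ.filter (fun x => ∀ v, ¬ E x v),
          ∑ᶠ l ∈ {l | IsDiPath E s x l}, pathProd A l =
            ∑ v ∈ Finset.univ.filter (fun v => E s v),
              A s v * ∑ᶠ l ∈ {l | IsDiPath E v x l}, pathProd A l := by
        intro x hx
        have hsx : s ≠ x := by
          rintro rfl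
          exact not_exists.2 (Finset.mem_filter.1 hx).2 hs
        rw [finsum_pathProd_of_ne_s5 hwf A hsx, ← finsum_mem_coe_finset]
        simp
      rw [Finset.sum_congr rfl hstep, Finset.sum_comm, ← hA s hs]
      refine Finset.sum_congr rfl fun v hv => ?_
      rw [← Finset.mul_sum, ih v (Finset.mem_filter.1 hv).2, mul_one]
    · have hterm := not_exists.1 hs
      rw [Finset.sum_eq_single_of_mem s (by simpa using hterm),
        setOf_isDiPath_self_of_terminal hterm, finsum_mem_singleton, pathProd]
      intro x _ hxs
      rw [finsum_pathProd_of_ne_s5 hwf A (Ne.symm hxs)]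
      simp [hterm]

/-- If `F` is everywhere positive, the allocation `A` is normalized over
the children of every non-terminal state, and the bifurcated flow-consistency constraint
`∑_{u ∈ Parents(s')} F u * A u s' = F s'` holds at every non-initial state, then the
allocations define a probability distribution over complete trajectories: the sum, over all
terminal states `x` and all directed paths from `s₀` to `x`, of the product of the
allocations along the path equals `1`. -/
theorem bn_allocations_define_probability_over_trajectories
    {S : Type*} [Fintype S] [DecidableEq S]
    (E : S → S → Prop) [DecidableRel E]
    -- the transitive closure of `E` is irreflexive (finite DAG)
    (hacyc : ∀ s : S, ¬ Relation.TransGen E s s)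
    (s₀ : S)
    -- the initial state has no incoming edges
    (hs₀_no_in : ∀ u : S, ¬ E u s₀)
    -- every state is reachable from the initial state
    (hreach : ∀ s : S, Relation.ReflTransGen E s₀ s)
    -- the initial state is not terminal
    (hs₀_not_term : ∃ v : S, E s₀ v)
    (F : S → ℝ)
    (hF_pos : ∀ s : S, 0 < F s)
    (A : S → S → ℝ)
    -- `A` is a nonnegative edge allocation supported on the edges
    (hA_nonneg : ∀ s s' : S, 0 ≤ A s s')
    (hA_supp : ∀ s s' : S, ¬ E s s' → A s s' = 0)
    -- normalization: at every non-terminal state the allocations over children sum to 1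
    (hA_norm : ∀ s : S, (∃ v : S, E s v) →
      ∑ v ∈ Finset.univ.filter (fun v => E s v), A s v = 1)
    -- bifurcated flow-consistency at every non-initial state
    (hflow : ∀ s' : S, s' ≠ s₀ →
      ∑ u ∈ Finset.univ.filter (fun u => E u s'), F u * A u s' = F s') :
    (∑ x ∈ Finset.univ.filter (fun x => ∀ v : S, ¬ E x v),
      ∑ᶠ l ∈ {l : List S | IsDiPath E s₀ x l}, pathProd A l) = 1 := by
  exact sum_finsum_pathProd_eq_one (wellFounded_flip_of_acyclic hacyc) hA_norm s₀
end
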